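/- arXiv:1208.0985 — 2 statements merged into one kernel-verified Lean document; each statement's English description precedes it below -/
import Mathlib

section
/- Let f be an orientation-preserving homeomorphism of the plane with no fixed points (a Brouwer homeomorphism). If D is a topological disk (a set homeomorphic to the open or closed unit disk) with f(D) ∩ D = ∅, then f^n(D) ∩ D = ∅ for every integer n ≠ 0. -/
/-- A homeomorphism of a space is orientation preserving if it is isotopic to the identity
(a standard characterization for homeomorphisms of the plane). -/
def OrientationPreserving {X : Type*} [TopologicalSpace X] (f : X ≃ₜ X) : Prop :=
  ∃ F : ℝ → X ≃ₜ X, (Continuous fun p : ℝ × X => F p.1 p.2) ∧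
    F 0 = Homeomorph.refl X ∧ F 1 = f

/-- A topological disk: a subset of the plane homeomorphic to the open or closed unit disk. -/
def IsTopologicalDisk (D : Set ℂ) : Prop :=
  Nonempty (↥D ≃ₜ ↥(Metric.ball (0 : ℂ) 1)) ∨
  Nonempty (↥D ≃ₜ ↥(Metric.closedBall (0 : ℂ) 1))

open Set Topology Metric

section Isotopy

variable {X : Type*} [TopologicalSpace X]

theorem OrientationPreserving.trans {f g : X ≃ₜ X} (hf : OrientationPreserving f)
    (hg : OrientationPreserving g) : OrientationPreserving (f.trans g) := by
  obtain ⟨F, hF, hF0, hF1⟩ := hf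
  obtain ⟨G, hG, hG0, hG1⟩ := hg
  refine ⟨fun t => (F t).trans (G t), ?_, ?_, ?_⟩
  · exact hG.comp (continuous_fst.prodMk hF)
  · ext x; simp [hF0, hG0]
  · simp [hF1, hG1]

end Isotopy

/-- The center of a disk can be moved to any other point of the disk by an orientation preserving
homeomorphism supported in the disk. -/
theorem exists_push_ball {b c : ℂ} {r : ℝ} (hb : dist b c < r) :
    ∃ h : ℂ ≃ₜ ℂ, OrientationPreserving h ∧ h c = b ∧ ∀ z ∉ ball c r, h z = z := by
  have hr : 0 < r := dist_nonneg.trans_lt hb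
  set v : ℂ := (b - c) / r with hv
  have hv1 : ‖v‖₊ < 1 := by
    rw [← NNReal.coe_lt_coe, coe_nnnorm, hv, norm_div, Complex.norm_real, Real.norm_of_nonneg hr.le,
      NNReal.coe_one, div_lt_one hr, ← dist_eq_norm]
    exact hb
  let s : ℝ → ℝ := fun t => max 0 (min 1 t)
  let φ : ℂ → ℝ := fun z => max 0 (r - dist z c)
  have hφ : ∀ z w, |φ z - φ w| ≤ ‖z - w‖ := fun z w => by
    refine (abs_max_sub_max_le_max 0 _ 0 _).trans ?_
    rw [sub_self, abs_zero, sub_sub_sub_cancel_left]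
    refine max_le (norm_nonneg _) ?_
    rw [← dist_eq_norm, dist_comm z w]
    exact abs_dist_sub_le w z c
  let H : ℝ → ℂ → ℂ := fun t z => z + ((s t * φ z : ℝ) : ℂ) * v
  have hH : ∀ t, ApproximatesLinearOn (H t)
      ((ContinuousLinearEquiv.refl ℝ ℂ : ℂ ≃L[ℝ] ℂ) : ℂ →L[ℝ] ℂ) univ ‖v‖₊ := fun t z _ w _ => by
    have h1 : H t z - H t w - (z - w) = ((s t * (φ z - φ w) : ℝ) : ℂ) * v := by
      simp only [H]; push_cast; ring
    have h2 : |s t| ≤ 1 := by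
      rw [abs_of_nonneg (le_max_left _ _)]
      exact max_le zero_le_one (min_le_left _ _)
    change ‖H t z - H t w - (z - w)‖ ≤ _
    rw [h1, norm_mul, Complex.norm_real, Real.norm_eq_abs, abs_mul, coe_nnnorm, mul_comm]
    gcongr
    calc |s t| * |φ z - φ w| ≤ 1 * ‖z - w‖ := by gcongr; exact hφ z w
      _ = ‖z - w‖ := one_mul _
  have hc : Subsingleton ℂ ∨ ‖v‖₊ <
      ‖((ContinuousLinearEquiv.refl ℝ ℂ).symm : ℂ →L[ℝ] ℂ)‖₊⁻¹ := by
    right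
    have : ‖((ContinuousLinearEquiv.refl ℝ ℂ).symm : ℂ →L[ℝ] ℂ)‖₊ = 1 :=
      NNReal.eq (ContinuousLinearMap.norm_id (𝕜 := ℝ) (E := ℂ))
    rw [this, inv_one]
    exact hv1
  have key : ∀ t z, (hH t).toHomeomorph (H t) hc z = H t z := fun _ _ => rfl
  refine ⟨(hH 1).toHomeomorph (H 1) hc,
    ⟨fun t => (hH t).toHomeomorph (H t) hc, ?_, ?_, rfl⟩, ?_, fun z hz => ?_⟩
  · simp only [key, H, s, φ]
    fun_prop
  · ext z
    rw [key]
    simp [H, s]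
  · have : (r : ℂ) ≠ 0 := by exact_mod_cast hr.ne'
    rw [key]
    simp only [H, s, φ, dist_self, sub_zero, max_eq_right hr.le, min_self,
      max_eq_right zero_le_one, one_mul, hv]
    field_simp
    ring
  · have : φ z = 0 := max_eq_left (by rw [mem_ball, not_lt] at hz; linarith)
    rw [key]
    simp [H, this]

theorem exists_push {U : Set ℂ} (hU : IsOpen U) (hUc : IsPreconnected U) {a b : ℂ}
    (ha : a ∈ U) (hb : b ∈ U) :
    ∃ h : ℂ ≃ₜ ℂ, OrientationPreserving h ∧ h a = b ∧ ∀ z ∉ U, h z = z := by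
  refine hUc.induction₂' (fun a b => ∃ h : ℂ ≃ₜ ℂ, OrientationPreserving h ∧ h a = b ∧
    ∀ z ∉ U, h z = z) (fun x hx => ?_) ?_ ha hb
  · obtain ⟨ε, hε, hεU⟩ := Metric.isOpen_iff.1 hU x hx
    refine mem_nhdsWithin_of_mem_nhds ?_
    filter_upwards [ball_mem_nhds x (half_pos hε)] with y hy
    rw [mem_ball] at hy
    obtain ⟨h, h1, h2, h3⟩ := exists_push_ball hy
    obtain ⟨k, k1, k2, k3⟩ := exists_push_ball (dist_comm y x ▸ hy)
    refine ⟨⟨h, h1, h2, fun z hz => h3 z fun hz' => hz (hεU ?_)⟩,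
      ⟨k, k1, k2, fun z hz => k3 z fun hz' => hz (hεU ?_)⟩⟩
    · exact ball_subset_ball (by linarith) hz'
    · rw [mem_ball] at hz' ⊢
      linarith [dist_triangle z y x]
  · rintro x y z - - - ⟨h, h1, h2, h3⟩ ⟨k, k1, k2, k3⟩
    refine ⟨h.trans k, h1.trans k1, by simp [h2, k2], fun w hw => ?_⟩
    simp [h3 w hw, k3 w hw]

/-- A Brouwer homeomorphism: an orientation preserving homeomorphism of the plane without fixed
points. -/
def IsBrouwer (f : ℂ ≃ₜ ℂ) : Prop :=
  OrientationPreserving f ∧ ∀ x, f x ≠ x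

theorem IsBrouwer.exists_perturb {f : ℂ ≃ₜ ℂ} (hf : IsBrouwer f) {U : Set ℂ} (hU : IsOpen U)
    (hUc : IsPreconnected U) (hfree : ∀ z ∈ U, f z ∉ U) {a b : ℂ} (ha : a ∈ U) (hb : b ∈ U) :
    ∃ g : ℂ ≃ₜ ℂ, IsBrouwer g ∧ (∀ z, f z = a → g z = b) ∧ ∀ z, f z ∉ U → g z = f z := by
  obtain ⟨h, h1, h2, h3⟩ := exists_push hU hUc ha hb
  refine ⟨f.trans h, ⟨hf.1.trans h1, fun z hz => ?_⟩, fun z hz => by simp [hz, h2],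
    fun z hz => h3 _ hz⟩
  rw [Homeomorph.trans_apply] at hz
  by_cases hfz : f z ∈ U
  · have hzU : z ∉ U := fun hz' => hfree z hz' hfz
    exact hzU ((h.injective (hz.trans (h3 z hzU).symm)) ▸ hfz)
  · exact hf.2 z ((h3 _ hfz).symm.trans hz)

theorem exists_continuous_log {A : Type*} [TopologicalSpace A] [SimplyConnectedSpace A]
    [LocallyPathConnectedSpace A] {G : A → ℂ} (hG : Continuous G) (hG0 : ∀ a, G a ≠ 0) :
    ∃ l : A → ℂ, Continuous l ∧ ∀ a, Complex.exp (l a) = G a := by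
  obtain ⟨a₀⟩ : Nonempty A := inferInstance
  obtain ⟨l, ⟨-, hl⟩, -⟩ := Complex.isCoveringMapOn_exp.existsUnique_continuousMap_lifts
    (⟨G, hG⟩ : C(A, ℂ)) (a₀ := a₀) (e₀ := Complex.log (G a₀)) (Complex.exp_log (hG0 a₀)) hG0
  exact ⟨l, l.continuous, fun a => congrFun hl a⟩

theorem eq_of_exp_eq_const {A : Type*} [TopologicalSpace A] [PreconnectedSpace A] {l : A → ℂ}
    (hl : Continuous l) {c : ℂ} (hc : ∀ a, Complex.exp (l a) = c) (a b : A) : l a = l b :=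
  congrFun (Complex.isCoveringMap_exp.eq_of_comp_eq hl continuous_const
    (by ext x; simp [hc]) b rfl) a

/-- A Brouwer homeomorphism has no point of period two. -/
theorem IsBrouwer.apply_apply_ne {f : ℂ ≃ₜ ℂ} (hf : IsBrouwer f) (x : ℂ) : f (f x) ≠ x := by
  intro hx
  obtain ⟨⟨F, hF, hF0, hF1⟩, hfix⟩ := hf
  let G : ℝ × ℂ → ℂ := fun p => F p.1 p.2 - F p.1 (f p.2)
  have hG : Continuous G := by
    refine hF.sub (hF.comp (continuous_fst.prodMk (f.continuous.comp continuous_snd)))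
  have hG0 : ∀ p, G p ≠ 0 := fun p h =>
    hfix p.2 ((F p.1).injective (sub_eq_zero.1 h)).symm
  obtain ⟨l, hl, hlG⟩ := exists_continuous_log hG hG0
  have e1 := eq_of_exp_eq_const (l := fun a => l (1, a) - l (0, f a)) (c := 1) (by fun_prop)
    (fun a => by
      rw [Complex.exp_sub, hlG, hlG, div_eq_one_iff_eq (hG0 _)]
      simp [G, hF0, hF1]) x (f x)
  have e2 := eq_of_exp_eq_const (l := fun t => l (t, f x) - l (t, x)) (c := -1) (by fun_prop)
    (fun t => by
      rw [Complex.exp_sub, hlG, hlG, div_eq_iff (hG0 _)]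
      simp [G, hx]) 0 1
  simp only [hx] at e1 e2
  have e3 : l (0, f x) = l (0, x) := by linear_combination (e2 - e1) / 2
  have e4 : G (0, f x) = G (0, x) := by rw [← hlG, ← hlG, e3]
  simp only [G, hF0, Homeomorph.refl_apply, hx, id] at e4
  exact hfix x (by linear_combination e4 / 2)

theorem exists_open_free {f : ℂ ≃ₜ ℂ} {K : Set ℂ} (hK : IsCompact K) (hKc : IsPreconnected K)
    (hfree : ∀ z ∈ K, f z ∉ K) :
    ∃ U, IsOpen U ∧ IsPreconnected U ∧ K ⊆ U ∧ ∀ z ∈ U, f z ∉ U := by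
  obtain ⟨V, W, hV, hW, hKV, hKW, hVW⟩ := SeparatedNhds.of_isCompact_isCompact hK
    (hK.image f.continuous) (by
      rw [disjoint_right]
      rintro _ ⟨z, hz, rfl⟩
      exact hfree z hz)
  obtain ⟨δ, hδ, hsub⟩ := hK.exists_thickening_subset_open (hV.inter (hW.preimage f.continuous))
    (subset_inter hKV (image_subset_iff.1 hKW))
  refine ⟨thickening δ K, isOpen_thickening, ?_, self_subset_thickening hδ K, fun z hz hfz => ?_⟩
  · rcases K.eq_empty_or_nonempty with rfl | ⟨k₀, hk₀⟩
    · simpa using isPreconnected_empty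
    refine isPreconnected_of_forall k₀ fun y hy => ?_
    obtain ⟨k, hk, hyk⟩ := mem_thickening_iff.1 hy
    refine ⟨K ∪ ball k δ, union_subset (self_subset_thickening hδ K)
      (ball_subset_thickening hk δ), .inl hk₀, .inr hyk, ?_⟩
    exact hKc.union k hk (mem_ball_self hδ) (convex_ball k δ).isPreconnected
  · exact disjoint_left.1 hVW (hsub hfz).1 (hsub hz).2

/-- No Brouwer homeomorphism has a periodic point whose period is at most `m`. -/
def NoPeriodUpTo (m : ℕ) : Prop :=
  ∀ f : ℂ ≃ₜ ℂ, IsBrouwer f → ∀ x k, 0 < k → k ≤ m → f^[k] x ≠ x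

theorem iterate_notMem_of_isOpen {m : ℕ} (hm : NoPeriodUpTo m) {f : ℂ ≃ₜ ℂ} (hf : IsBrouwer f)
    {U : Set ℂ} (hU : IsOpen U) (hUc : IsPreconnected U) (hfree : ∀ z ∈ U, f z ∉ U) {a : ℂ}
    (ha : a ∈ U) {k : ℕ} (hk : 0 < k) (hkm : k ≤ m) : f^[k] a ∉ U := by
  induction k using Nat.strong_induction_on with
  | _ k ih =>
  intro hka
  obtain ⟨g, hg, hg1, hg2⟩ := hf.exists_perturb hU hUc hfree hka ha
  have key : ∀ j < k, g^[j] a = f^[j] a := by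
    intro j
    induction j with
    | zero => simp
    | succ j ihj =>
      intro hj
      rw [Function.iterate_succ_apply', ihj (by omega), Function.iterate_succ_apply']
      apply hg2
      rw [← Function.iterate_succ_apply' f]
      exact ih _ hj (by omega) (by omega)
  obtain ⟨j, rfl⟩ : ∃ j, k = j + 1 := ⟨k - 1, by omega⟩
  refine hm g hg a (j + 1) hk hkm ?_
  rw [Function.iterate_succ_apply', key j (by omega)]
  exact hg1 _ (Function.iterate_succ_apply' f j a).symm

theorem iterate_notMem_of_isCompact {m : ℕ} (hm : NoPeriodUpTo m) {f : ℂ ≃ₜ ℂ} (hf : IsBrouwer f)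
    {K : Set ℂ} (hK : IsCompact K) (hKc : IsPreconnected K) (hfree : ∀ z ∈ K, f z ∉ K) {a : ℂ}
    (ha : a ∈ K) {k : ℕ} (hk : 0 < k) (hkm : k ≤ m) : f^[k] a ∉ K := by
  obtain ⟨U, hU, hUc, hKU, hUf⟩ := exists_open_free hK hKc hfree
  exact fun h => iterate_notMem_of_isOpen hm hf hU hUc hUf (hKU ha) hk hkm (hKU h)

/-- For every point `x` there is a round disk centered at `x` which touches its image, but only
along its boundary. -/
theorem exists_critical_radius {f : ℂ ≃ₜ ℂ} (hfix : ∀ x, f x ≠ x) (x : ℂ) :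
    ∃ r : ℝ, 0 < r ∧ (∃ y, dist y x = r ∧ dist (f y) x = r) ∧
      ∀ p, dist p x ≤ r → dist (f p) x ≤ r → dist p x = r ∧ dist (f p) x = r := by
  let M : ℂ → ℝ := fun p => max (dist p x) (dist (f p) x)
  have hM : Continuous M := by fun_prop
  obtain ⟨y, hy⟩ := hM.exists_forall_le
    (Filter.tendsto_atTop_mono (fun p => le_max_left _ _) (tendsto_dist_right_cocompact_atTop x))
  set r := M y with hr
  have hr0 : 0 < r := by
    refine (dist_nonneg.trans (le_max_left _ _)).lt_of_ne fun h => hfix y ?_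
    have h1 : dist y x ≤ 0 := h ▸ le_max_left _ _
    have h2 : dist (f y) x ≤ 0 := h ▸ le_max_right _ _
    rw [dist_le_zero] at h1 h2
    exact h2.trans h1.symm
  have key : ∀ p, dist p x ≤ r → dist (f p) x ≤ r → dist p x = r ∧ dist (f p) x = r := by
    intro p h1 h2
    constructor
    · refine h1.eq_of_not_lt fun h3 => ?_
      have hcl : f p ∈ closure (ball x r) := by rwa [closure_ball x hr0.ne']
      obtain ⟨q, hq1, hq2⟩ := mem_closure_iff.1 hcl (f.symm ⁻¹' ball x r)
        (isOpen_ball.preimage f.symm.continuous) (by simpa using h3)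
      have := hy (f.symm q)
      simp only [M, f.apply_symm_apply] at this
      exact absurd this (not_le.2 (max_lt hq1 hq2))
    · refine h2.eq_of_not_lt fun h3 => ?_
      have hcl : p ∈ closure (ball x r) := by rwa [closure_ball x hr0.ne']
      obtain ⟨q, hq1, hq2⟩ := mem_closure_iff.1 hcl (f ⁻¹' ball x r)
        (isOpen_ball.preimage f.continuous) (by simpa using h3)
      exact absurd (hy q) (not_le.2 (max_lt hq2 hq1))
  exact ⟨r, hr0, ⟨y, key y (le_max_left _ _) (le_max_right _ _)⟩, key⟩

theorem noPeriodUpTo_two : NoPeriodUpTo 2 := by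
  intro f hf x k hk hk2
  interval_cases k
  · exact hf.2 x
  · exact hf.apply_apply_ne x

theorem NoPeriodUpTo.succ {m : ℕ} (hm : NoPeriodUpTo m) (hm2 : 2 ≤ m) : NoPeriodUpTo (m + 1) := by
  intro f hf x k hk hkm hx
  obtain hk' | rfl := Nat.le_succ_iff.1 hkm
  · exact hm f hf x k hk hk' hx
  obtain ⟨r, hr, ⟨y, hy, hfy⟩, hcrit⟩ := exists_critical_radius hf.2 x
  -- `P` and `Q` parametrize the radii from the center `x` to `y` and to `f y`.
  let P : ℝ → ℂ := fun s => x + s * (y - x)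
  let Q : ℝ → ℂ := fun t => x + t * (f y - x)
  have hP : Continuous P := by fun_prop
  have hQ : Continuous Q := by fun_prop
  have hP0 : P 0 = x := by simp [P]
  have hQ0 : Q 0 = x := by simp [Q]
  have hP1 : P 1 = y := by simp [P]
  have hQ1 : Q 1 = f y := by simp [Q]
  have hdP : ∀ s, 0 ≤ s → dist (P s) x = s * r := fun s hs => by
    simp only [P, dist_eq_norm, add_sub_cancel_left, norm_mul, Complex.norm_real,
      Real.norm_of_nonneg hs]
    rw [← dist_eq_norm, hy]
  have hdQ : ∀ s, 0 ≤ s → dist (Q s) x = s * r := fun s hs => by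
    simp only [Q, dist_eq_norm, add_sub_cancel_left, norm_mul, Complex.norm_real,
      Real.norm_of_nonneg hs]
    rw [← dist_eq_norm, hfy]
  have hdP' : ∀ s ∈ Icc (0 : ℝ) 1, dist (P s) x ≤ r := fun s hs => by
    rw [hdP s hs.1]; nlinarith [hs.2]
  have hdQ' : ∀ s ∈ Icc (0 : ℝ) 1, dist (Q s) x ≤ r := fun s hs => by
    rw [hdQ s hs.1]; nlinarith [hs.2]
  have hPr : ∀ s ∈ Icc (0 : ℝ) 1, dist (P s) x = r → s = 1 := fun s hs h => by
    rw [hdP s hs.1] at h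
    exact mul_right_cancel₀ hr.ne' (h.trans (one_mul r).symm)
  have hQr : ∀ s ∈ Icc (0 : ℝ) 1, dist (Q s) x = r → s = 1 := fun s hs h => by
    rw [hdQ s hs.1] at h
    exact mul_right_cancel₀ hr.ne' (h.trans (one_mul r).symm)
  -- A subset of the closed disk with a single boundary point is free.
  have hfree : ∀ (K : Set ℂ) (q : ℂ), (∀ p ∈ K, dist p x ≤ r) → (∀ p ∈ K, dist p x = r → p = q) →
      ∀ p ∈ K, f p ∉ K := fun K q h1 h2 p hp hfp => by
    obtain ⟨h3, h4⟩ := hcrit p (h1 p hp) (h1 _ hfp)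
    exact hf.2 p ((h2 _ hfp h4).trans (h2 p hp h3).symm)
  have hPfree : ∀ s ∈ Icc (0 : ℝ) 1, ∀ s' ∈ Icc (0 : ℝ) 1, f (P s) ≠ P s' := by
    intro s hs s' hs' h
    refine hfree (P '' Icc 0 1) y ?_ ?_ (P s) (mem_image_of_mem P hs) (h ▸ mem_image_of_mem P hs')
    · rintro _ ⟨u, hu, rfl⟩
      exact hdP' u hu
    · rintro _ ⟨u, hu, rfl⟩ h
      rw [hPr u hu h, hP1]
  have hQfree : ∀ s ∈ Icc (0 : ℝ) 1, ∀ s' ∈ Icc (0 : ℝ) 1, f (Q s) ≠ Q s' := by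
    intro s hs s' hs' h
    refine hfree (Q '' Icc 0 1) (f y) ?_ ?_ (Q s) (mem_image_of_mem Q hs)
      (h ▸ mem_image_of_mem Q hs')
    · rintro _ ⟨u, hu, rfl⟩
      exact hdQ' u hu
    · rintro _ ⟨u, hu, rfl⟩ h
      rw [hQr u hu h, hQ1]
  have hPQ : ∀ s ∈ Icc (0 : ℝ) 1, 0 < s → ∀ t ∈ Icc (0 : ℝ) 1, P s ≠ Q t := by
    intro s hs hs0 t ht h
    have h1 : s = t := mul_right_cancel₀ hr.ne' (by rw [← hdP s hs.1, ← hdQ t ht.1, h])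
    subst h1
    have h2 : (s : ℂ) ≠ 0 := by exact_mod_cast hs0.ne'
    have h3 : y - x = f y - x := mul_left_cancel₀ h2 (add_left_cancel h)
    exact hf.2 y (sub_left_injective h3).symm
  have hPPQ : ∀ s ∈ Icc (0 : ℝ) 1, ∀ t ∈ Icc (0 : ℝ) 1, f (f (P s)) ≠ Q t := by
    intro s hs t ht h
    -- Unless `s = t = 1`, the two radii cut at `P s` and `Q t` form a free set.
    have aux : ∀ q, (∀ p ∈ P '' Icc 0 s ∪ Q '' Icc 0 t, dist p x = r → p = q) → False := by
      intro q hq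
      have hc : IsCompact (P '' Icc 0 s ∪ Q '' Icc 0 t) :=
        (isCompact_Icc.image hP).union (isCompact_Icc.image hQ)
      have hpc : IsPreconnected (P '' Icc 0 s ∪ Q '' Icc 0 t) :=
        IsPreconnected.union x ⟨0, left_mem_Icc.2 hs.1, hP0⟩ ⟨0, left_mem_Icc.2 ht.1, hQ0⟩
          (isPreconnected_Icc.image P hP.continuousOn) (isPreconnected_Icc.image Q hQ.continuousOn)
      refine iterate_notMem_of_isCompact hm hf hc hpc (hfree _ q ?_ hq) (a := P s)
        (.inl ⟨s, right_mem_Icc.2 hs.1, rfl⟩) two_pos hm2 (.inr ⟨t, right_mem_Icc.2 ht.1, h.symm⟩)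
      rintro _ (⟨u, hu, rfl⟩ | ⟨u, hu, rfl⟩)
      · exact hdP' u ⟨hu.1, hu.2.trans hs.2⟩
      · exact hdQ' u ⟨hu.1, hu.2.trans ht.2⟩
    rcases hs.2.eq_or_lt with rfl | hs1
    · rcases ht.2.eq_or_lt with rfl | ht1
      · rw [hP1, hQ1] at h
        exact hf.2 _ h
      · refine aux y ?_
        rintro _ (⟨u, hu, rfl⟩ | ⟨u, hu, rfl⟩) hur
        · rw [hPr u hu hur, hP1]
        · exact absurd (hQr u ⟨hu.1, hu.2.trans ht.2⟩ hur) (hu.2.trans_lt ht1).ne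
    · refine aux (f y) ?_
      rintro _ (⟨u, hu, rfl⟩ | ⟨u, hu, rfl⟩) hur
      · exact absurd (hPr u ⟨hu.1, hu.2.trans hs.2⟩ hur) (hu.2.trans_lt hs1).ne
      · rw [hQr u ⟨hu.1, hu.2.trans ht.2⟩ hur, hQ1]
  have h0 : (0 : ℝ) ∈ Icc (0 : ℝ) 1 := left_mem_Icc.2 zero_le_one
  -- `Z` is a closed set which the perturbation at `x` has to avoid.
  let C : Set ℂ := (fun t => f (Q t)) '' Icc 0 1 ∪ (fun s => f (f (P s))) '' Icc 0 1
  let Z : Set ℂ := C ∪ (fun j => f^[j] x) '' Icc 1 m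
  have hZ : IsClosed Z := by
    refine IsClosed.union (IsClosed.union ?_ ?_) ((finite_Icc 1 m).image _).isClosed
    · exact (isCompact_Icc.image (by fun_prop)).isClosed
    · exact (isCompact_Icc.image (by fun_prop)).isClosed
  have hxZ : x ∉ Z := by
    rintro ((⟨t, ht, h⟩ | ⟨s, hs, h⟩) | ⟨j, hj, h⟩)
    · exact hQfree t ht 0 h0 (h.trans hQ0.symm)
    · exact hPPQ s hs 0 h0 (h.trans hQ0.symm)
    · exact hm f hf x j hj.1 hj.2 h
  obtain ⟨U, hU, -, hxU, hUf⟩ := exists_open_free (f := f) isCompact_singleton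
    (isPreconnected_singleton (x := x)) (by simpa using hf.2 x)
  obtain ⟨ε, hε, hεU⟩ := nhds_basis_closedBall.mem_iff.1
    ((hU.inter hZ.isOpen_compl).mem_nhds ⟨hxU rfl, hxZ⟩)
  have hWU : ∀ z ∈ ball x ε, z ∈ U ∧ z ∉ Z := fun z hz => hεU (ball_subset_closedBall hz)
  -- Choose a point `P s` close to `x` whose orbit follows that of `x`.
  have hcont : ∀ j, Filter.Tendsto (fun s => f^[j] (P s)) (𝓝[>] 0) (𝓝 (f^[j] x)) := fun j => by
    have : Continuous fun s => f^[j] (P s) := (f.continuous.iterate j).comp hP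
    simpa only [hP0] using (this.tendsto 0).mono_left nhdsWithin_le_nhds
  have hev1 : ∀ᶠ s in 𝓝[>] (0 : ℝ), ∀ j ∈ Icc 1 m, f^[j] (P s) ∉ closedBall x ε := by
    rw [(finite_Icc 1 m).eventually_all]
    intro j hj
    exact (hcont j).eventually (isClosed_closedBall.isOpen_compl.mem_nhds fun h =>
      (hεU h).2 (.inr ⟨j, hj, rfl⟩))
  have hev2 : ∀ᶠ s in 𝓝[>] (0 : ℝ), f^[m + 1] (P s) ∈ ball x ε :=
    (hcont (m + 1)).eventually (by rw [hx]; exact ball_mem_nhds x hε)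
  obtain ⟨s, ⟨hs1, hs2⟩, hs⟩ := ((hev1.and hev2).and (Ioc_mem_nhdsGT zero_lt_one)).exists
  have hsub : Icc s 1 ⊆ Icc 0 1 := Icc_subset_Icc_left hs.1.le
  obtain ⟨g, hg, hg1, hg2⟩ := hf.exists_perturb isOpen_ball (convex_ball x ε).isPreconnected
    (fun z hz hfz => hUf z (hWU z hz).1 (hWU _ hfz).1) hs2 (mem_ball_self hε)
  let K : Set ℂ := Q '' Icc 0 1 ∪ (fun u => f (P u)) '' Icc s 1
  have hK : IsCompact K :=
    (isCompact_Icc.image hQ).union (isCompact_Icc.image (by fun_prop))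
  have hKc : IsPreconnected K := by
    refine IsPreconnected.union (f y) ⟨1, right_mem_Icc.2 zero_le_one, hQ1⟩
      ⟨1, right_mem_Icc.2 hs.2, by simp [hP1]⟩ (isPreconnected_Icc.image Q hQ.continuousOn)
      (isPreconnected_Icc.image _ (by fun_prop))
  have hfK : ∀ z ∈ K, f z ∈ C := by
    rintro _ (⟨t, ht, rfl⟩ | ⟨u, hu, rfl⟩)
    · exact .inl ⟨t, ht, rfl⟩
    · exact .inr ⟨u, hsub hu, rfl⟩
  have hKf : ∀ z ∈ K, f z ∉ K := by
    rintro _ (⟨t, ht, rfl⟩ | ⟨u, hu, rfl⟩) (⟨t', ht', h⟩ | ⟨u', hu', h⟩)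
    · exact hQfree t ht t' ht' h.symm
    · exact hPQ u' (hsub hu') (hs.1.trans_le hu'.1) t ht (f.injective h)
    · exact hPPQ u (hsub hu) t' ht' h.symm
    · exact hPfree u (hsub hu) u' (hsub hu') (f.injective h).symm
  have hKg : ∀ z ∈ K, g z ∉ K := fun z hz => by
    rw [hg2 z fun h => (hWU _ h).2 (.inl (hfK z hz))]
    exact hKf z hz
  have horb : ∀ j < m, g^[j] (f (P s)) = f^[j] (f (P s)) := by
    intro j
    induction j with
    | zero => simp
    | succ j ih =>
      intro hj
      rw [Function.iterate_succ_apply', ih (by omega), Function.iterate_succ_apply']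
      apply hg2
      rw [← Function.iterate_succ_apply' f, ← Function.iterate_succ_apply f]
      exact fun h => hs1 (j + 1 + 1) ⟨by omega, by omega⟩ (ball_subset_closedBall h)
  refine iterate_notMem_of_isCompact hm hg hK hKc hKg (a := f (P s))
    (.inr ⟨s, left_mem_Icc.2 hs.2, rfl⟩) (by omega) le_rfl ?_
  obtain ⟨l, rfl⟩ : ∃ l, m = l + 1 := ⟨m - 1, by omega⟩
  rw [Function.iterate_succ_apply', horb l (by omega), hg1]
  · exact .inl ⟨0, h0, hQ0⟩
  · rw [← Function.iterate_succ_apply' f, ← Function.iterate_succ_apply f]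

theorem noPeriodUpTo (m : ℕ) : NoPeriodUpTo m := by
  have h : NoPeriodUpTo (m + 2) := by
    induction m with
    | zero => exact noPeriodUpTo_two
    | succ m ih => exact ih.succ (by omega)
  exact fun f hf x k hk hkm => h f hf x k hk (by omega)

theorem IsTopologicalDisk.isPathConnected {D : Set ℂ} (hD : IsTopologicalDisk D) :
    IsPathConnected D := by
  rw [isPathConnected_iff_pathConnectedSpace]
  rcases hD with ⟨⟨e⟩⟩ | ⟨⟨e⟩⟩
  · have := isPathConnected_iff_pathConnectedSpace.1
      ((convex_ball (0 : ℂ) 1).isPathConnected ⟨0, mem_ball_self one_pos⟩)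
    exact e.symm.surjective.pathConnectedSpace e.symm.continuous
  · have := isPathConnected_iff_pathConnectedSpace.1
      ((convex_closedBall (0 : ℂ) 1).isPathConnected ⟨0, mem_closedBall_self zero_le_one⟩)
    exact e.symm.surjective.pathConnectedSpace e.symm.continuous

theorem IsBrouwer.iterate_notMem {f : ℂ ≃ₜ ℂ} (hf : IsBrouwer f) {D : Set ℂ}
    (hD : IsPathConnected D) (hfree : ∀ z ∈ D, f z ∉ D) {a : ℂ} (ha : a ∈ D) {n : ℕ}
    (hn : 0 < n) : f^[n] a ∉ D := by
  intro hb
  obtain ⟨γ, hγ⟩ := hD.joinedIn a ha _ hb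
  have hsub : range γ ⊆ D := range_subset_iff.2 hγ
  exact iterate_notMem_of_isCompact (noPeriodUpTo n) hf (isCompact_range γ.continuous)
    (isPreconnected_range γ.continuous) (fun z hz h => hfree z (hsub hz) (hsub h))
    ⟨0, γ.source⟩ hn le_rfl ⟨1, γ.target⟩

/-- The free disk lemma: for a Brouwer homeomorphism `f` (orientation preserving, fixed point
free homeomorphism of the plane), a free topological disk is disjoint from all its iterates. -/
theorem stmt_0 (f : ℂ ≃ₜ ℂ) (hor : OrientationPreserving f)
    (hfree : ∀ x : ℂ, f x ≠ x)
    (D : Set ℂ) (hD : IsTopologicalDisk D)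
    (hdisj : f '' D ∩ D = ∅) :
    ∀ n : ℤ, n ≠ 0 → (f.toEquiv ^ n) '' D ∩ D = ∅ := by

  have hiter : ∀ (k : ℕ) (x : ℂ), (f.toEquiv ^ k) x = f^[k] x := fun k x => by
    rw [← Equiv.Perm.iterate_eq_pow]
    rfl
  have hfreeD : ∀ z ∈ D, f z ∉ D := fun z hz h =>
    (hdisj ▸ ⟨mem_image_of_mem f hz, h⟩ : f z ∈ (∅ : Set ℂ))
  intro n hn
  rw [eq_empty_iff_forall_notMem]
  rintro _ ⟨⟨x, hx, rfl⟩, hx'⟩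
  have key : ∀ a ∈ D, ∀ k : ℕ, 0 < k → (f.toEquiv ^ k) a ∉ D := fun a ha k hk => by
    rw [hiter]
    exact IsBrouwer.iterate_notMem ⟨hor, hfree⟩ hD.isPathConnected hfreeD ha hk
  obtain ⟨k, rfl | rfl⟩ := n.eq_nat_or_neg
  · exact key x hx k (by omega) (by simpa using hx')
  · refine key _ hx' k (by omega) ?_
    simpa [zpow_neg, zpow_natCast] using hx
end

section
/- Let f be a Brouwer homeomorphism and let α be a translation arc for f, i.e. a simple arc with α(1) = f(α(0)) and α ∩ f(α) = {α(1)}. Then f^n(α) ∩ α ≠ ∅ if and only if n ∈ {-1, 0, 1}. -/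
/-- A nowhere vanishing continuous function on a nonempty convex open set has a continuous
logarithm. -/
theorem exists_continuousOn_log {E : Type*} [NormedAddCommGroup E] [NormedSpace ℝ E]
    {S : Set E} (hconv : Convex ℝ S) (hne : S.Nonempty) (hopen : IsOpen S)
    {D : E → ℂ} (hD : ContinuousOn D S) (h0 : ∀ x ∈ S, D x ≠ 0) :
    ∃ L : E → ℂ, ContinuousOn L S ∧ ∀ x ∈ S, Complex.exp (L x) = D x := by
  obtain ⟨x₀, hx₀⟩ := hne
  have : ContractibleSpace S := hconv.contractibleSpace ⟨x₀, hx₀⟩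
  have : LocallyPathConnectedSpace S := hopen.locallyPathConnectedSpace
  obtain ⟨G, ⟨-, hG⟩, -⟩ := Complex.isCoveringMapOn_exp.existsUnique_continuousMap_lifts
    (⟨S.domRestrict D, hD.domRestrict⟩ : C(S, ℂ)) (a₀ := ⟨x₀, hx₀⟩) (e₀ := Complex.log (D x₀))
    (Complex.exp_log (h0 x₀ hx₀)) (fun a => h0 a a.2)
  classical
  have hval (x : S) : (fun x => if hx : x ∈ S then G ⟨x, hx⟩ else 0) (x : E) = G x := by simp
  refine ⟨fun x => if hx : x ∈ S then G ⟨x, hx⟩ else 0, ?_, fun x hx => ?_⟩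
  · rw [continuousOn_iff_continuous_domRestrict]
    exact G.continuous.congr fun x => (hval x).symm
  · rw [hval ⟨x, hx⟩]
    exact congrFun hG ⟨x, hx⟩

/-- A continuous function with constant exponential is constant on preconnected sets. -/
theorem IsPreconnected.eq_of_exp_eq {X : Type*} [TopologicalSpace X] {S : Set X}
    (hS : IsPreconnected S) {g : X → ℂ} (hg : ContinuousOn g S) {c : ℂ}
    (hc : ∀ x ∈ S, Complex.exp (g x) = c) {x y : X} (hx : x ∈ S) (hy : y ∈ S) : g x = g y :=
  Complex.isCoveringMap_exp.constOn_of_comp hS hg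
    (fun a ha b hb => Subtype.ext ((hc a ha).trans (hc b hb).symm)) hx hy

/-- An equivariant line in the plane cannot have a shortest self-intersection at a distance
greater than one, for a Brouwer homeomorphism. -/
theorem not_shortest_return {f : ℂ ≃ₜ ℂ} (hor : OrientationPreserving f)
    (hfree : ∀ x : ℂ, f x ≠ x) {Γ : ℝ → ℂ} (hΓ : Continuous Γ)
    (hshift : ∀ s, Γ (s + 1) = f (Γ s)) {s₀ T : ℝ} (hT : 1 < T)
    (hreturn : Γ (s₀ + T) = Γ s₀)
    (hsimple : ∀ s t, s < t → t < s + T → Γ s ≠ Γ t) : False := by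
  obtain ⟨F, hF, hF0, hF1⟩ := hor
  have hF0' (z : ℂ) : F 0 z = z := by rw [hF0]; rfl
  obtain ⟨θ, hθ, hexpθ⟩ := exists_continuousOn_log (convex_univ (𝕜 := ℝ) (E := ℂ))
    Set.univ_nonempty isOpen_univ (D := fun z => f z - z) (by fun_prop)
    (fun z _ => sub_ne_zero.2 (hfree z))
  rw [continuousOn_univ] at hθ
  -- The open strip where the chords of the line, moved by the isotopy, do not vanish.
  let S : Set (ℝ × ℝ × ℝ) := {p | p.2.1 < p.2.2 ∧ p.2.2 < p.2.1 + T}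
  have hSopen : IsOpen S := by
    have h1 : IsOpen {p : ℝ × ℝ × ℝ | p.2.1 < p.2.2} := isOpen_lt (by fun_prop) (by fun_prop)
    have h2 : IsOpen {p : ℝ × ℝ × ℝ | p.2.2 < p.2.1 + T} := isOpen_lt (by fun_prop) (by fun_prop)
    exact h1.inter h2
  have hSconv : Convex ℝ S := by
    rintro ⟨τ, s, t⟩ ⟨h1, h2⟩ ⟨τ', s', t'⟩ ⟨h3, h4⟩ a b ha hb hab
    simp only [S, Set.mem_ofPred_eq, Prod.smul_mk, Prod.mk_add_mk, smul_eq_mul] at *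
    obtain rfl : b = 1 - a := by linarith
    rcases ha.eq_or_lt with rfl | ha
    · constructor <;> linarith
    · constructor <;> nlinarith
  have hFΓ (g : ℝ × ℝ × ℝ → ℝ) (hg : Continuous g) : Continuous fun p => F p.1 (Γ (g p)) :=
    hF.comp (continuous_fst.prodMk (hΓ.comp hg))
  obtain ⟨L, hL, hexpL⟩ := exists_continuousOn_log hSconv
    ⟨(0, 0, 1), by simp only [S, Set.mem_ofPred_eq]; constructor <;> linarith⟩ hSopen
    (D := fun p => F p.1 (Γ p.2.2) - F p.1 (Γ p.2.1))
    ((hFΓ _ (by fun_prop)).sub (hFΓ _ (by fun_prop))).continuousOn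
    (fun p hp => sub_ne_zero.2 fun h => hsimple _ _ hp.1 hp.2 ((F p.1).injective h).symm)
  have mem_S {τ s t : ℝ} (h1 : s < t) (h2 : t < s + T) : (τ, s, t) ∈ S := ⟨h1, h2⟩
  have hxT (τ : ℝ) : F τ (Γ (s₀ + T)) = F τ (Γ s₀) := by rw [hreturn]
  -- Pushing the line by `f` changes the logarithm of chords by a constant.
  have hpush {s t s' t' : ℝ} (h1 : s < t) (h2 : t < s + T) (h3 : s' < t') (h4 : t' < s' + T) :
      L (0, s + 1, t + 1) - L (1, s, t) = L (0, s' + 1, t' + 1) - L (1, s', t') := by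
    refine hSconv.isPreconnected.eq_of_exp_eq
      (g := fun p => L (0, p.2.1 + 1, p.2.2 + 1) - L (1, p.2.1, p.2.2)) (c := 1) ?_ ?_
      (mem_S (τ := 0) h1 h2) (mem_S (τ := 0) h3 h4)
    · refine (hL.comp (by fun_prop) fun p hp => ?_).sub (hL.comp (by fun_prop) fun p hp => ?_)
      · exact mem_S (by linarith [hp.1]) (by linarith [hp.2])
      · exact mem_S hp.1 hp.2
    · intro p hp
      rw [Complex.exp_sub, hexpL _ (mem_S (by linarith [hp.1]) (by linarith [hp.2])),
        hexpL _ (mem_S hp.1 hp.2)]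
      simp only [hF0', hF1, hshift]
      exact div_self (sub_ne_zero.2 fun h => hsimple _ _ hp.1 hp.2 (f.injective h).symm)
  -- The total variation of the chord angle seen from the double point is isotopy invariant.
  have hexp_turn (τ s : ℝ) (h1 : s₀ < s) (h2 : s < s₀ + T) :
      Complex.exp (L (τ, s, s₀ + T) - L (τ, s₀, s)) = -1 := by
    rw [Complex.exp_sub, hexpL _ (mem_S h2 (by linarith)), hexpL _ (mem_S h1 h2)]
    simp only [hxT]
    rw [← neg_sub, neg_div, div_self]
    exact sub_ne_zero.2 fun h => hsimple _ _ h1 h2 ((F τ).injective h).symm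
  have hturn {τ s τ' s' : ℝ} (h1 : s₀ < s) (h2 : s < s₀ + T) (h3 : s₀ < s') (h4 : s' < s₀ + T) :
      L (τ, s, s₀ + T) - L (τ, s₀, s) = L (τ', s', s₀ + T) - L (τ', s₀, s') := by
    refine ((convex_univ (𝕜 := ℝ) (E := ℝ)).prod
      (convex_Ioo s₀ (s₀ + T))).isPreconnected.eq_of_exp_eq
      (g := fun p : ℝ × ℝ => L (p.1, p.2, s₀ + T) - L (p.1, s₀, p.2)) (c := -1) ?_
      (fun p hp => hexp_turn p.1 p.2 hp.2.1 hp.2.2)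
      (x := (τ, s)) (y := (τ', s')) ⟨trivial, h1, h2⟩ ⟨trivial, h3, h4⟩
    refine (hL.comp (by fun_prop) fun p hp => ?_).sub (hL.comp (by fun_prop) fun p hp => ?_)
    · exact mem_S hp.2.2 (by linarith [hp.2.1])
    · exact mem_S hp.2.1 hp.2.2
  -- Since `f` has no fixed point, the index along the loop vanishes.
  have hindex : L (0, s₀ + T, s₀ + T + 1) = L (0, s₀, s₀ + 1) := by
    have := isPreconnected_univ.eq_of_exp_eq
      (g := fun s : ℝ => L (0, s, s + 1) - θ (Γ s)) (c := 1) ?_ ?_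
      (Set.mem_univ (s₀ + T)) (Set.mem_univ s₀)
    · simpa [hreturn] using this
    · refine (hL.comp (by fun_prop) fun s _ => ?_).sub (hθ.comp hΓ).continuousOn
      exact mem_S (by linarith) (by linarith)
    · intro s _
      rw [Complex.exp_sub, hexpL _ (mem_S (by linarith) (by linarith)), hexpθ _ trivial]
      simp only [hF0', hshift]
      exact div_self (sub_ne_zero.2 (hfree _))
  have e1 := hturn (τ := 0) (s := s₀ + 1) (τ' := 1) (s' := s₀ + T - 1)
    (by linarith) (by linarith) (by linarith) (by linarith)
  have e2 := hpush (s := s₀ + T - 1) (t := s₀ + T) (s' := s₀) (t' := s₀ + T - 1)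
    (by linarith) (by linarith) (by linarith) (by linarith)
  have e3 := hexp_turn 0 (s₀ + 1) (by linarith) (by linarith)
  rw [sub_add_cancel] at e2
  have hzero : L (0, s₀ + 1, s₀ + T) - L (0, s₀, s₀ + 1) = 0 := by
    linear_combination (1 / 2) * e1 - (1 / 2) * e2 + (1 / 2) * hindex
  rw [hzero, Complex.exp_zero] at e3
  norm_num at e3

/-- The line obtained by concatenating the iterates under `f` of the path `a : [0, 1] → X`. -/
noncomputable def iterateLine {X : Type*} [TopologicalSpace X] (f : X ≃ₜ X) (a : ℝ → X)
    (s : ℝ) : X :=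
  (f ^ ⌊s⌋) (a (Int.fract s))

section iterateLine

variable {X : Type*} [TopologicalSpace X] {f : X ≃ₜ X} {a : ℝ → X}

theorem iterateLine_add_int (s : ℝ) (k : ℤ) :
    iterateLine f a (s + k) = (f ^ k) (iterateLine f a s) := by
  simp only [iterateLine, Int.floor_add_intCast, Int.fract_add_intCast, add_comm ⌊s⌋, zpow_add,
    Homeomorph.mul_apply]

theorem iterateLine_int_add (hend : a 1 = f (a 0)) (k : ℤ) {s : ℝ} (hs : s ∈ Set.Icc (0 : ℝ) 1) :
    iterateLine f a (k + s) = (f ^ k) (a s) := by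
  rw [add_comm, iterateLine_add_int]
  congr 1
  rcases hs.2.eq_or_lt with rfl | h1
  · simp [iterateLine, hend]
  · have h0 : ⌊s⌋ = 0 := Int.floor_eq_zero_iff.2 ⟨hs.1, h1⟩
    simp [iterateLine, Int.fract, h0]

theorem continuous_iterateLine (ha : Continuous a) (hend : a 1 = f (a 0)) :
    Continuous (iterateLine f a) := by
  have hlf : LocallyFinite fun k : ℤ => Set.Icc (k : ℝ) (k + 1) :=
    locallyFinite_Icc_of_tendsto
      (tendsto_intCast_atTop_iff.2 Filter.tendsto_id)
      (Filter.tendsto_atBot_add_const_right _ 1 (tendsto_intCast_atBot_iff.2 Filter.tendsto_id))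
  refine hlf.continuous (iUnion_Icc_intCast ℝ) (fun _ => isClosed_Icc) fun k => ?_
  have hk : Continuous fun s : ℝ => (f ^ k) (a (s - k)) :=
    (f ^ k).continuous.comp (ha.comp (by fun_prop))
  refine hk.continuousOn.congr fun s hs => ?_
  have := iterateLine_int_add hend k (s := s - k)
    ⟨by linarith [hs.1], by linarith [hs.2]⟩
  rwa [add_sub_cancel] at this

end iterateLine

theorem Homeomorph.toEquiv_zpow {X : Type*} [TopologicalSpace X] (f : X ≃ₜ X) (n : ℤ) :
    (f ^ n).toEquiv = f.toEquiv ^ n :=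
  map_zpow (MonoidHom.mk' (fun g : X ≃ₜ X => (g.toEquiv : Equiv.Perm X)) fun _ _ => rfl) f n

/-- The iterates of order at least two of a translation arc are disjoint from it. -/
theorem translationArc_zpow_ne (f : ℂ ≃ₜ ℂ) (hor : OrientationPreserving f)
    (hfree : ∀ x : ℂ, f x ≠ x)
    (α : C(unitInterval, ℂ)) (hinj : Function.Injective α)
    (hend : α 1 = f (α 0))
    (hmeet : Set.range α ∩ f '' Set.range α = {α 1}) {n : ℤ} (hn : 2 ≤ n)
    (u v : unitInterval) : (f ^ n) (α u) ≠ α v := by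
  intro huv
  let a : ℝ → ℂ := Set.IccExtend zero_le_one α
  have ha : Continuous a := α.continuous.Icc_extend'
  have ha_coe (u : unitInterval) : a u = α u := Set.IccExtend_val _ _ _
  have haend : a 1 = f (a 0) := by
    have h0 : a 0 = α 0 := ha_coe 0
    have h1 : a 1 = α 1 := ha_coe 1
    rw [h0, h1, hend]
  set Γ := iterateLine f a with hΓdef
  have hΓ : Continuous Γ := continuous_iterateLine ha haend
  have hΓarc (k : ℤ) (u : unitInterval) : Γ (k + u) = (f ^ k) (α u) := by
    rw [hΓdef, iterateLine_int_add haend k u.2, ha_coe]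
  have hΓ0 (u : unitInterval) : Γ u = α u := by simpa using hΓarc 0 u
  have hΓ1 (u : unitInterval) : Γ (1 + u) = f (α u) := by simpa using hΓarc 1 u
  have hearly (s t : ℝ) (hs : s ∈ Set.Icc (0 : ℝ) 1) (hst : s < t) (ht : t ≤ 2) : Γ s ≠ Γ t := by
    intro h
    have hs' : Γ s = α ⟨s, hs⟩ := hΓ0 ⟨s, hs⟩
    rcases le_total t 1 with ht1 | ht1
    · have ht' : t ∈ Set.Icc (0 : ℝ) 1 := ⟨hs.1.trans hst.le, ht1⟩
      rw [hs', show Γ t = α ⟨t, ht'⟩ from hΓ0 ⟨t, ht'⟩] at h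
      exact hst.ne (congrArg Subtype.val (hinj h))
    · have ht' : t - 1 ∈ Set.Icc (0 : ℝ) 1 := ⟨by linarith, by linarith⟩
      have ht'' : Γ t = f (α ⟨t - 1, ht'⟩) := by simpa using hΓ1 ⟨t - 1, ht'⟩
      rw [hs', ht''] at h
      have hmem : α ⟨s, hs⟩ ∈ Set.range α ∩ f '' Set.range α :=
        ⟨⟨_, rfl⟩, ⟨_, ⟨_, rfl⟩, h.symm⟩⟩
      rw [hmeet, Set.mem_singleton_iff] at hmem
      have e1 : s = 1 := congrArg Subtype.val (hinj hmem)
      have e2 : t - 1 = 0 :=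
        congrArg Subtype.val (hinj (f.injective (h.symm.trans (hmem.trans hend))))
      linarith
  have hn' : (2 : ℝ) ≤ n := by exact_mod_cast hn
  let P : Set (ℝ × ℝ) := (Set.Icc 0 1 ×ˢ Set.Icc 2 ((n : ℝ) + u + 1)) ∩ {p | Γ p.1 = Γ p.2}
  have hPcompact : IsCompact P :=
    (isCompact_Icc.prod isCompact_Icc).inter_right (isClosed_eq (by fun_prop) (by fun_prop))
  have hPmem : ((v : ℝ), (n : ℝ) + u) ∈ P :=
    ⟨⟨v.2, by linarith [u.2.1], by simp⟩, by
      simp only [Set.mem_ofPred_eq]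
      rw [hΓ0, hΓarc, huv]⟩
  obtain ⟨⟨s₀, t₀⟩, ⟨⟨hs₀, ht₀⟩, h₀⟩, hmin⟩ :=
    hPcompact.exists_isMinOn ⟨_, hPmem⟩ (f := fun p => p.2 - p.1) (by fun_prop)
  simp only at hs₀ ht₀ h₀
  have ht₀' : 2 < t₀ := by
    refine lt_of_le_of_ne ht₀.1 ?_
    rintro rfl
    exact hearly s₀ 2 hs₀ (by linarith [hs₀.2]) le_rfl h₀
  refine not_shortest_return hor hfree hΓ (fun s => ?_) (s₀ := s₀) (T := t₀ - s₀)
    (by linarith [hs₀.2]) (by rw [add_sub_cancel]; exact h₀.symm) fun s t hst htT h => ?_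
  · simpa using iterateLine_add_int (f := f) (a := a) s 1
  · have hfr : Int.fract s ∈ Set.Icc (0 : ℝ) 1 := ⟨Int.fract_nonneg s, (Int.fract_lt_one s).le⟩
    have hs : s = Int.fract s + ⌊s⌋ := (Int.fract_add_floor s).symm
    have ht : t = (t - ⌊s⌋) + ⌊s⌋ := by ring
    have hΓeq : Γ (Int.fract s) = Γ (t - ⌊s⌋) := by
      rw [hs, ht] at h
      simp only [hΓdef, iterateLine_add_int] at h
      simpa using h
    have hlt : Int.fract s < t - ⌊s⌋ := by linarith
    have hle : 2 < t - ⌊s⌋ := by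
      by_contra! hle
      exact hearly _ _ hfr hlt hle hΓeq
    have hmin₀ : t₀ - s₀ ≤ (n : ℝ) + u - v := hmin hPmem
    have hmin₁ : t₀ - s₀ ≤ (t - ⌊s⌋) - Int.fract s :=
      hmin (a := (Int.fract s, t - ⌊s⌋))
        ⟨⟨hfr, hle.le, by simp only; linarith [hfr.2, v.2.1]⟩, hΓeq⟩
    linarith

/-- A translation arc for a Brouwer homeomorphism meets its iterate `f^n(α)`
exactly when `n ∈ {-1, 0, 1}`. -/
theorem stmt_2 (f : ℂ ≃ₜ ℂ) (hor : OrientationPreserving f)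
    (hfree : ∀ x : ℂ, f x ≠ x)
    (α : C(unitInterval, ℂ)) (hinj : Function.Injective α)
    (hend : α 1 = f (α 0))
    (hmeet : Set.range α ∩ f '' Set.range α = {α 1}) :
    ∀ n : ℤ, ((f.toEquiv ^ n) '' Set.range α ∩ Set.range α).Nonempty ↔
      (n = -1 ∨ n = 0 ∨ n = 1) := by
  intro n
  rw [← Homeomorph.toEquiv_zpow]
  constructor
  · rintro ⟨_, ⟨_, ⟨u, rfl⟩, hu⟩, v, rfl⟩
    replace hu : (f ^ n) (α u) = α v := hu
    by_contra! hn
    rcases le_total 0 n with h | h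
    · exact translationArc_zpow_ne f hor hfree α hinj hend hmeet (by lia) u v hu
    · refine translationArc_zpow_ne f hor hfree α hinj hend hmeet (n := -n) (by lia) v u ?_
      rw [← hu, ← Homeomorph.mul_apply, ← zpow_add, neg_add_cancel, zpow_zero,
        Homeomorph.one_apply]
  · rintro (rfl | rfl | rfl)
    · refine ⟨α 0, ⟨α 1, ⟨1, rfl⟩, ?_⟩, 0, rfl⟩
      change (f ^ (-1 : ℤ)) (α 1) = α 0
      rw [zpow_neg_one, hend, Homeomorph.inv_apply, Homeomorph.symm_apply_apply]
    · exact ⟨α 0, ⟨α 0, ⟨0, rfl⟩, rfl⟩, 0, rfl⟩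
    · refine ⟨α 1, ⟨α 0, ⟨0, rfl⟩, ?_⟩, 1, rfl⟩
      change (f ^ (1 : ℤ)) (α 0) = α 1
      rw [zpow_one, hend]
end
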